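/- arXiv:1004.4267 — 2 statements merged into one kernel-verified Lean document; each statement's English description precedes it below -/
import Mathlib

section
/- Let n ≥ 1, μ > 0, α > 0, γ ≥ 0, t, t' > 0, x, x' ∈ ℝⁿ, and 0 < b < n. Let L : (0,∞) → (0,∞) be slowly varying at infinity and bounded on each finite interval, and set K(n,b) := Γ((n−b)/2)/(2^b π^{n/2} Γ(b/2)). Let k ≥ 1 be an integer and g : ℝⁿ → [0,∞) measurable such that g is bounded on {|λ| ≥ δ₀} for every δ₀ > 0 and g(λ)·|λ|^{n−b}/(K(n,b)·L^k(1/|λ|)) → 1 as λ → 0. Then lim_{ε→0⁺} ε^{n/α}·(ε^{b/α} L^k(ε^{−1/α}))^{−1}·∫_{ℝⁿ} e^{i⟨x−x',λ⟩} e^{−μ(t+t')|λ|^α(1+|ε^{1/α}λ|²)^{γ/2}} g(ε^{1/α} λ) dλ = K(n,b)·∫_{ℝⁿ} e^{i⟨x−x',λ⟩} e^{−μ(t+t')|λ|^{α}} |λ|^{b−n} dλ. -/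
open MeasureTheory Filter Topology
open scoped RealInnerProductSpace

/-- `L` is slowly varying at infinity: `L(cy)/L(y) → 1` as `y → ∞`, uniformly
for `c` in compact subintervals of `(0,∞)`. -/
def SlowlyVaryingAtTop (L : ℝ → ℝ) : Prop :=
  ∀ a b : ℝ, 0 < a → a < b →
    TendstoUniformlyOn (fun y c => L (c * y) / L y) (fun _ => 1) atTop (Set.Icc a b)

/-- The Tauberian constant `K(n,c) = Γ((n−c)/2)/(2^c π^{n/2} Γ(c/2))`. -/
noncomputable def tauberK (n : ℕ) (c : ℝ) : ℝ :=
  Real.Gamma (((n : ℝ) - c) / 2) /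
    ((2 : ℝ) ^ c * Real.pi ^ ((n : ℝ) / 2) * Real.Gamma (c / 2))

theorem SlowlyVaryingAtTop.pow {L : ℝ → ℝ} (hL : SlowlyVaryingAtTop L) (k : ℕ) :
    SlowlyVaryingAtTop (fun y => L y ^ k) := by
  intro a b ha hab
  rw [Metric.tendstoUniformlyOn_iff]
  intro ε hε
  obtain ⟨δ, hδ, h⟩ := Metric.continuousAt_iff.1
    ((continuous_pow k).continuousAt : ContinuousAt (fun x : ℝ => x ^ k) 1) ε hε
  filter_upwards [Metric.tendstoUniformlyOn_iff.1 (hL a b ha hab) δ hδ] with y hy c hc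
  have := h (by rw [dist_comm]; exact hy c hc)
  rw [dist_comm]
  simpa [div_pow] using this

/-- Pointwise form of slow variation. -/
theorem SlowlyVaryingAtTop.tendsto_div {L : ℝ → ℝ} (hL : SlowlyVaryingAtTop L) {c : ℝ}
    (hc : 0 < c) : Tendsto (fun y => L (c * y) / L y) atTop (𝓝 1) :=
  (hL c (c + 1) hc (by linarith)).tendsto_at ⟨le_rfl, by linarith⟩

/-- Control of a slowly varying function over one octave. -/
theorem SlowlyVaryingAtTop.exists_octave_bound {L : ℝ → ℝ} (hL : SlowlyVaryingAtTop L)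
    (hpos : ∀ y > 0, 0 < L y) {η : ℝ} (hη : 0 < η) :
    ∃ Y > 0, ∀ y z, Y ≤ y → y ≤ z → z ≤ 2 * y →
      L z ≤ 2 ^ η * L y ∧ L y ≤ 2 ^ η * L z := by
  have h1 : (1 : ℝ) < 2 ^ η := Real.one_lt_rpow (by norm_num) hη
  have hδ : 0 < 1 - ((2 : ℝ) ^ η)⁻¹ := by
    rw [sub_pos]; exact inv_lt_one_of_one_lt₀ h1
  obtain ⟨Y, hY⟩ := eventually_atTop.1
    (Metric.tendstoUniformlyOn_iff.1 (hL 1 2 one_pos one_lt_two) _ hδ)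
  refine ⟨max Y 1, by positivity, fun y z hy hyz hz => ?_⟩
  have hy0 : 0 < y := lt_of_lt_of_le one_pos ((le_max_right _ _).trans hy)
  have hLy := hpos y hy0
  have hLz := hpos z (hy0.trans_le hyz)
  have h := hY y ((le_max_left _ _).trans hy) (z / y)
    ⟨(one_le_div hy0).2 hyz, (div_le_iff₀ hy0).2 hz⟩
  rw [div_mul_cancel₀ _ hy0.ne', Real.dist_eq, abs_lt] at h
  set q : ℝ := (2 : ℝ) ^ η
  have hq : 0 < q := by linarith
  have hsum : 2 - q⁻¹ ≤ q := by
    have : q⁻¹ * q = 1 := inv_mul_cancel₀ hq.ne'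
    have h2 : 0 < q⁻¹ := by positivity
    nlinarith [mul_nonneg h2.le (sq_nonneg (q - 1))]
  constructor
  · rw [← div_le_iff₀ hLy]; linarith [h.1]
  · have : q⁻¹ ≤ L z / L y := by linarith [h.2]
    rw [le_div_iff₀ hLy] at this
    calc L y = q * (q⁻¹ * L y) := by field_simp
      _ ≤ q * L z := by gcongr

/-- Potter's bounds. -/
theorem SlowlyVaryingAtTop.potter {L : ℝ → ℝ} (hL : SlowlyVaryingAtTop L)
    (hpos : ∀ y > 0, 0 < L y) {η : ℝ} (hη : 0 < η) :
    ∃ Y > 0, ∀ y z, Y ≤ y → y ≤ z →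
      L z ≤ 2 ^ η * (z / y) ^ η * L y ∧ L y ≤ 2 ^ η * (z / y) ^ η * L z := by
  obtain ⟨Y, hY0, hY⟩ := hL.exists_octave_bound hpos hη
  refine ⟨Y, hY0, fun y z hy hyz => ?_⟩
  have hy0 : 0 < y := hY0.trans_le hy
  have key : ∀ m : ℕ, ∀ z, y ≤ z → z ≤ 2 ^ m * y →
      L z ≤ 2 ^ η * (z / y) ^ η * L y ∧ L y ≤ 2 ^ η * (z / y) ^ η * L z := by
    intro m
    have base : ∀ z, y ≤ z → z ≤ 2 * y →
        L z ≤ 2 ^ η * (z / y) ^ η * L y ∧ L y ≤ 2 ^ η * (z / y) ^ η * L z := by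
      intro z hyz hz
      have h1 : 1 ≤ (z / y) ^ η := Real.one_le_rpow ((one_le_div hy0).2 hyz) hη.le
      have hLy := hpos y hy0
      have hLz := hpos z (hy0.trans_le hyz)
      have h2 : (2 : ℝ) ^ η ≤ 2 ^ η * (z / y) ^ η :=
        le_mul_of_one_le_right (by positivity) h1
      obtain ⟨ha, hb⟩ := hY y z hy hyz hz
      exact ⟨ha.trans (by gcongr), hb.trans (by gcongr)⟩
    induction m with
    | zero => exact fun z hyz hz => base z hyz (by linarith)
    | succ m ih =>
      intro z hyz hz
      rcases le_total z (2 * y) with h | h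
      · exact base z hyz h
      · obtain ⟨ha, hb⟩ := ih (z / 2) (by linarith) (by rw [pow_succ] at hz; linarith)
        obtain ⟨hc, hd⟩ := hY (z / 2) z (by linarith) (by linarith) (by linarith)
        have hz0 : 0 < z := hy0.trans_le hyz
        have e : (2 : ℝ) ^ η * (z / 2 / y) ^ η = (z / y) ^ η := by
          rw [← Real.mul_rpow (by norm_num) (by positivity)]
          congr 1; field_simp
        rw [e] at ha hb
        constructor
        · calc L z ≤ 2 ^ η * L (z / 2) := hc
            _ ≤ 2 ^ η * ((z / y) ^ η * L y) := by gcongr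
            _ = _ := by ring
        · calc L y ≤ (z / y) ^ η * L (z / 2) := hb
            _ ≤ (z / y) ^ η * (2 ^ η * L z) := by gcongr
            _ = _ := by ring
  obtain ⟨m, hm⟩ := pow_unbounded_of_one_lt (z / y) (one_lt_two : (1 : ℝ) < 2)
  exact key m z hyz ((div_le_iff₀ hy0).1 hm.le)

/-- Symmetric form of Potter's bounds, with no ordering of the two arguments. -/
theorem SlowlyVaryingAtTop.exists_le_mul_rpow_add {L : ℝ → ℝ} (hL : SlowlyVaryingAtTop L)
    (hpos : ∀ y > 0, 0 < L y) {η : ℝ} (hη : 0 < η) :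
    ∃ Y > 0, ∀ y z, Y ≤ y → Y ≤ z →
      L z ≤ 2 ^ η * ((y / z) ^ η + (y / z) ^ (-η)) * L y := by
  obtain ⟨Y, hY0, hY⟩ := hL.potter hpos hη
  refine ⟨Y, hY0, fun y z hy hz => ?_⟩
  have hy0 := hY0.trans_le hy
  have hz0 := hY0.trans_le hz
  have hLy := (hpos y hy0).le
  have h0 : 0 < y / z := by positivity
  rcases le_total y z with h | h
  · refine (hY y z hy h).1.trans ?_
    rw [← inv_div y z, Real.inv_rpow h0.le, ← Real.rpow_neg h0.le]
    gcongr
    exact le_add_of_nonneg_left (by positivity)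
  · refine (hY z y hz h).2.trans ?_
    gcongr
    exact le_add_of_nonneg_right (by positivity)

theorem integrable_norm_rpow_mul_exp_neg {n : ℕ} (hn : 1 ≤ n) {c α p : ℝ} (hc : 0 < c)
    (hα : 0 < α) (hp : -(n : ℝ) < p) :
    Integrable (fun l : EuclideanSpace ℝ (Fin n) => ‖l‖ ^ p * Real.exp (-(c * ‖l‖ ^ α))) := by
  have : Nonempty (Fin n) := ⟨⟨0, hn⟩⟩
  rw [integrable_fun_norm_addHaar volume (f := fun r : ℝ => r ^ p * Real.exp (-(c * r ^ α)))]
  have hval := integral_rpow_mul_exp_neg_mul_rpow (p := α) (q := p + n - 1) (b := c) hα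
    (by linarith) hc
  have hint : IntegrableOn (fun r : ℝ => r ^ (p + n - 1) * Real.exp (-c * r ^ α))
      (Set.Ioi 0) := by
    apply Integrable.of_integral_ne_zero
    rw [hval]
    have := Real.Gamma_pos_of_pos (s := (p + n - 1 + 1) / α) (by apply div_pos <;> linarith)
    positivity
  refine hint.congr_fun (fun r hr => ?_) measurableSet_Ioi
  have hr : 0 < r := hr
  simp only [finrank_euclideanSpace, Fintype.card_fin, smul_eq_mul]
  rw [← mul_assoc, ← Real.rpow_natCast, ← Real.rpow_add hr, Nat.cast_sub hn, neg_mul]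
  congr 2
  push_cast; ring

/-- Uniform domination of the rescaled density. -/
theorem exists_scaled_density_bound {n : ℕ} {b K η : ℝ} (hK : 0 < K) (hη : 0 < η)
    (hηn : η < n - b)
    {L : ℝ → ℝ} (hLpos : ∀ y > 0, 0 < L y) (hL : SlowlyVaryingAtTop L)
    {g : EuclideanSpace ℝ (Fin n) → ℝ} (hg : ∀ l, 0 ≤ g l)
    (hgbdd : ∀ δ₀ > 0, ∃ C, ∀ l : EuclideanSpace ℝ (Fin n), δ₀ ≤ ‖l‖ → g l ≤ C)
    (hgasymp : Tendsto
      (fun l : EuclideanSpace ℝ (Fin n) => g l * ‖l‖ ^ ((n : ℝ) - b) / (K * L (1 / ‖l‖)))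
      (𝓝[≠] (0 : EuclideanSpace ℝ (Fin n))) (𝓝 1)) :
    ∃ C, ∀ᶠ s : ℝ in 𝓝[>] 0, ∀ l : EuclideanSpace ℝ (Fin n), l ≠ 0 →
      s ^ ((n : ℝ) - b) / L (1 / s) * g (s • l) ≤
        C * (‖l‖ ^ (b - n + η) + ‖l‖ ^ (b - n - η) + ‖l‖ ^ (0 : ℝ)) := by
  obtain ⟨Y, hY0, hY⟩ := hL.exists_le_mul_rpow_add hLpos hη
  obtain ⟨Z, hZ0, hZ⟩ := hL.potter hLpos hη
  obtain ⟨δ, hδ, hδg⟩ := Metric.eventually_nhds_iff.1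
    (eventually_nhdsWithin_iff.1 (hgasymp.eventually_le_const (one_lt_two : (1 : ℝ) < 2)))
  obtain ⟨C, hC⟩ := hgbdd (min δ (1 / Y)) (by positivity)
  have hLZ := hLpos Z hZ0
  set D := 2 ^ η * (Z ^ η)⁻¹ / L Z * |C| with hD
  have hD0 : 0 ≤ D := by positivity
  refine ⟨2 * K * 2 ^ η + D, ?_⟩
  have hs1 : ∀ᶠ s : ℝ in 𝓝[>] 0, s < min 1 (min (1 / Y) (1 / Z)) :=
    (Iio_mem_nhds (by positivity) : Set.Iio _ ∈ 𝓝 (0 : ℝ)) |> mem_nhdsWithin_of_mem_nhds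
  filter_upwards [hs1, self_mem_nhdsWithin] with s hs hs0 l hl
  have hs0 : 0 < s := hs0
  simp only [lt_min_iff] at hs
  obtain ⟨hs1, hsY, hsZ⟩ := hs
  have hYs : Y ≤ 1 / s := by rw [le_div_comm₀ hY0 hs0]; exact hsY.le
  have hZs : Z ≤ 1 / s := by rw [le_div_comm₀ hZ0 hs0]; exact hsZ.le
  have hLs := hLpos (1 / s) (by positivity)
  have hl0 : 0 < ‖l‖ := norm_pos_iff.2 hl
  have hnorm : ‖s • l‖ = s * ‖l‖ := by rw [norm_smul, Real.norm_of_nonneg hs0.le]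
  have hp1 : 0 ≤ ‖l‖ ^ (b - n + η) + ‖l‖ ^ (b - n - η) := by positivity
  rw [Real.rpow_zero]
  rcases lt_or_ge ‖s • l‖ (min δ (1 / Y)) with h | h
  · have h' := lt_min_iff.1 h
    have hsl : s • l ≠ 0 := smul_ne_zero hs0.ne' hl
    have h1 := hδg (y := s • l) (by simpa using h'.1) hsl
    have hsl0 : 0 < s * ‖l‖ := by positivity
    rw [hnorm] at h1 h'
    have hYl : Y ≤ 1 / (s * ‖l‖) := by rw [le_div_comm₀ hY0 hsl0]; exact h'.2.le
    have hLl := hLpos (1 / (s * ‖l‖)) (by positivity)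
    have h2 := hY _ _ hYs hYl
    have e : 1 / s / (1 / (s * ‖l‖)) = ‖l‖ := by field_simp
    rw [e] at h2
    rw [div_le_iff₀ (by positivity), Real.mul_rpow hs0.le hl0.le] at h1
    have e1 : ‖l‖ ^ (b - n + η) = (‖l‖ ^ ((n : ℝ) - b))⁻¹ * ‖l‖ ^ η := by
      rw [← Real.rpow_neg hl0.le, ← Real.rpow_add hl0]; congr 1; ring
    have e2 : ‖l‖ ^ (b - n - η) = (‖l‖ ^ ((n : ℝ) - b))⁻¹ * ‖l‖ ^ (-η) := by
      rw [← Real.rpow_neg hl0.le, ← Real.rpow_add hl0]; congr 1; ring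
    have hP : 0 < ‖l‖ ^ ((n : ℝ) - b) := by positivity
    have main : s ^ ((n : ℝ) - b) / L (1 / s) * g (s • l) ≤
        2 * K * 2 ^ η * (‖l‖ ^ (b - n + η) + ‖l‖ ^ (b - n - η)) := by
      rw [e1, e2, div_mul_eq_mul_div, div_le_iff₀ hLs]
      have h3 : g (s • l) * (s ^ ((n : ℝ) - b) * ‖l‖ ^ ((n : ℝ) - b)) ≤
          2 * (K * (2 ^ η * (‖l‖ ^ η + ‖l‖ ^ (-η)) * L (1 / s))) :=
        h1.trans (by gcongr)
      calc s ^ ((n : ℝ) - b) * g (s • l)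
          = (‖l‖ ^ ((n : ℝ) - b))⁻¹ *
            (g (s • l) * (s ^ ((n : ℝ) - b) * ‖l‖ ^ ((n : ℝ) - b))) := by field_simp
        _ ≤ (‖l‖ ^ ((n : ℝ) - b))⁻¹ *
            (2 * (K * (2 ^ η * (‖l‖ ^ η + ‖l‖ ^ (-η)) * L (1 / s)))) := by gcongr
        _ = _ := by ring
    have : 0 ≤ 2 * K * 2 ^ η := by positivity
    nlinarith [mul_nonneg hD0 hp1]
  · have h1 : g (s • l) ≤ |C| := (hC _ h).trans (le_abs_self C)
    have h2 := (hZ _ _ le_rfl hZs).2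
    have h3 : s ^ ((n : ℝ) - b) / L (1 / s) ≤ 2 ^ η * (Z ^ η)⁻¹ / L Z := by
      rw [div_le_div_iff₀ hLs hLZ]
      have e3 : (1 / s / Z) ^ η = (s ^ η)⁻¹ * (Z ^ η)⁻¹ := by
        rw [Real.div_rpow (by positivity) hZ0.le, one_div, Real.inv_rpow hs0.le]; rfl
      rw [e3] at h2
      have h4 : s ^ ((n : ℝ) - b) ≤ s ^ η :=
        Real.rpow_le_rpow_of_exponent_ge hs0 hs1.le hηn.le
      calc s ^ ((n : ℝ) - b) * L Z
          ≤ s ^ η * (2 ^ η * ((s ^ η)⁻¹ * (Z ^ η)⁻¹) * L (1 / s)) := by gcongr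
        _ = _ := by field_simp
    have h5 : s ^ ((n : ℝ) - b) / L (1 / s) * g (s • l) ≤ D := by
      rw [hD]; have := hg (s • l); gcongr
    have : 0 ≤ 2 * K * 2 ^ η := by positivity
    nlinarith [mul_nonneg hD0 hp1, mul_nonneg this hp1]

/-- Pointwise limit of the rescaled density. -/
theorem tendsto_scaled_density {n : ℕ} {b K : ℝ} (hK : 0 < K)
    {L : ℝ → ℝ} (hLpos : ∀ y > 0, 0 < L y) (hL : SlowlyVaryingAtTop L)
    {g : EuclideanSpace ℝ (Fin n) → ℝ}
    (hgasymp : Tendsto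
      (fun l : EuclideanSpace ℝ (Fin n) => g l * ‖l‖ ^ ((n : ℝ) - b) / (K * L (1 / ‖l‖)))
      (𝓝[≠] (0 : EuclideanSpace ℝ (Fin n))) (𝓝 1))
    {l : EuclideanSpace ℝ (Fin n)} (hl : l ≠ 0) :
    Tendsto (fun s : ℝ => s ^ ((n : ℝ) - b) / L (1 / s) * g (s • l)) (𝓝[>] 0)
      (𝓝 (K * ‖l‖ ^ (b - n))) := by
  have hl0 : 0 < ‖l‖ := norm_pos_iff.2 hl
  have h1 : Tendsto (fun s : ℝ => s • l) (𝓝[>] 0) (𝓝[≠] 0) := by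
    refine tendsto_nhdsWithin_iff.2 ⟨?_, ?_⟩
    · have : Tendsto (fun s : ℝ => s • l) (𝓝 0) (𝓝 ((0 : ℝ) • l)) :=
        (continuous_id.smul continuous_const).tendsto 0
      rw [zero_smul] at this
      exact this.mono_left nhdsWithin_le_nhds
    · filter_upwards [self_mem_nhdsWithin] with s hs
      exact smul_ne_zero (ne_of_gt hs) hl
  have h2 := (hL.tendsto_div (c := 1 / ‖l‖) (by positivity)).comp tendsto_inv_nhdsGT_zero
  have h3 := ((hgasymp.comp h1).mul h2).mul_const (K * ‖l‖ ^ (b - n))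
  rw [one_mul, one_mul] at h3
  refine h3.congr' ?_
  filter_upwards [self_mem_nhdsWithin] with s hs
  have hs : 0 < s := hs
  have e : 1 / ‖l‖ * s⁻¹ = 1 / (s * ‖l‖) := by field_simp
  have hnorm : ‖s • l‖ = s * ‖l‖ := by rw [norm_smul, Real.norm_of_nonneg hs.le]
  have := hLpos (1 / (s * ‖l‖)) (by positivity)
  have e2 : ‖l‖ ^ (b - n) = (‖l‖ ^ ((n : ℝ) - b))⁻¹ := by
    rw [← Real.rpow_neg hl0.le]; congr 1; ring
  have := hLpos (1 / s) (by positivity)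
  simp only [Function.comp, e, hnorm, e2, Real.mul_rpow hs.le hl0.le]
  rw [← one_div s]
  field_simp

/-- The macro-scaling limit in terms of the spatial scale `s`. -/
theorem tendsto_scaled_integral {n : ℕ} (hn : 1 ≤ n) {c α γ b K : ℝ} (hc : 0 < c) (hα : 0 < α)
    (hγ : 0 ≤ γ) (hb : 0 < b) (hbn : b < n) (hK : 0 < K) (v : EuclideanSpace ℝ (Fin n))
    {L : ℝ → ℝ} (hLpos : ∀ y > 0, 0 < L y) (hL : SlowlyVaryingAtTop L)
    {g : EuclideanSpace ℝ (Fin n) → ℝ} (hgmeas : Measurable g) (hg : ∀ l, 0 ≤ g l)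
    (hgbdd : ∀ δ₀ > 0, ∃ C, ∀ l : EuclideanSpace ℝ (Fin n), δ₀ ≤ ‖l‖ → g l ≤ C)
    (hgasymp : Tendsto
      (fun l : EuclideanSpace ℝ (Fin n) => g l * ‖l‖ ^ ((n : ℝ) - b) / (K * L (1 / ‖l‖)))
      (𝓝[≠] (0 : EuclideanSpace ℝ (Fin n))) (𝓝 1)) :
    Tendsto (fun s : ℝ => ∫ l : EuclideanSpace ℝ (Fin n),
        ((s ^ ((n : ℝ) - b) / L (1 / s) : ℝ) : ℂ) *
        (Complex.exp (Complex.I * ((⟪v, l⟫ : ℝ) : ℂ)) *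
          ↑(Real.exp (-(c * ‖l‖ ^ α * (1 + ‖s • l‖ ^ 2) ^ (γ / 2))) * g (s • l))))
      (𝓝[>] 0)
      (𝓝 (∫ l : EuclideanSpace ℝ (Fin n), (K : ℂ) *
          (Complex.exp (Complex.I * ((⟪v, l⟫ : ℝ) : ℂ)) *
            ↑(Real.exp (-(c * ‖l‖ ^ α)) * ‖l‖ ^ (b - (n : ℝ)))))) := by
  have : Nonempty (Fin n) := ⟨⟨0, hn⟩⟩
  obtain ⟨η, hη, hη'⟩ := exists_between (lt_min hb (sub_pos.2 hbn))
  obtain ⟨hηb, hηn⟩ := lt_min_iff.1 hη'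
  obtain ⟨C, hC⟩ := exists_scaled_density_bound hK hη hηn hLpos hL hg hgbdd hgasymp
  have hae : ∀ᵐ l : EuclideanSpace ℝ (Fin n), l ≠ 0 :=
    compl_mem_ae_iff.2 (measure_singleton 0)
  have hexp (l : EuclideanSpace ℝ (Fin n)) :
      ‖Complex.exp (Complex.I * ((⟪v, l⟫ : ℝ) : ℂ))‖ = 1 := by
    rw [mul_comm]; exact Complex.norm_exp_ofReal_mul_I _
  refine tendsto_integral_filter_of_dominated_convergence
    (fun l => C * (‖l‖ ^ (b - n + η) * Real.exp (-(c * ‖l‖ ^ α)) +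
      ‖l‖ ^ (b - n - η) * Real.exp (-(c * ‖l‖ ^ α)) +
      ‖l‖ ^ (0 : ℝ) * Real.exp (-(c * ‖l‖ ^ α)))) ?_ ?_ ?_ ?_
  · refine Eventually.of_forall fun s => Measurable.aestronglyMeasurable ?_
    have : Measurable fun l : EuclideanSpace ℝ (Fin n) => g (s • l) :=
      hgmeas.comp (measurable_const_smul s)
    fun_prop
  · filter_upwards [hC, self_mem_nhdsWithin] with s hs hs0
    have hs0 : 0 < s := hs0
    filter_upwards [hae] with l hl
    have hLs := hLpos (1 / s) (by positivity)
    have hgs := hg (s • l)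
    have hle : Real.exp (-(c * ‖l‖ ^ α * (1 + ‖s • l‖ ^ 2) ^ (γ / 2))) ≤
        Real.exp (-(c * ‖l‖ ^ α)) := by
      rw [Real.exp_le_exp, neg_le_neg_iff]
      exact le_mul_of_one_le_right (by positivity)
        (Real.one_le_rpow (by nlinarith [sq_nonneg ‖s • l‖]) (by positivity))
    rw [norm_mul, norm_mul, hexp, one_mul, Complex.norm_real, Complex.norm_real,
      Real.norm_of_nonneg (by positivity), Real.norm_of_nonneg (by positivity)]
    calc _ ≤ s ^ ((n : ℝ) - b) / L (1 / s) * (Real.exp (-(c * ‖l‖ ^ α)) * g (s • l)) := by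
          gcongr
      _ = (s ^ ((n : ℝ) - b) / L (1 / s) * g (s • l)) * Real.exp (-(c * ‖l‖ ^ α)) := by ring
      _ ≤ C * (‖l‖ ^ (b - n + η) + ‖l‖ ^ (b - n - η) + ‖l‖ ^ (0 : ℝ)) *
          Real.exp (-(c * ‖l‖ ^ α)) := by
          exact mul_le_mul_of_nonneg_right (hs l hl) (Real.exp_pos _).le
      _ = _ := by ring
  · refine (((integrable_norm_rpow_mul_exp_neg hn hc hα ?_).add
      (integrable_norm_rpow_mul_exp_neg hn hc hα ?_)).add
      (integrable_norm_rpow_mul_exp_neg hn hc hα ?_)).const_mul C <;> linarith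
  · filter_upwards [hae] with l hl
    have h1 := tendsto_scaled_density hK hLpos hL hgasymp hl
    have h2 : Tendsto (fun s : ℝ =>
        Real.exp (-(c * ‖l‖ ^ α * (1 + ‖s • l‖ ^ 2) ^ (γ / 2)))) (𝓝[>] 0)
        (𝓝 (Real.exp (-(c * ‖l‖ ^ α)))) := by
      have hcont : Continuous fun s : ℝ =>
          Real.exp (-(c * ‖l‖ ^ α * (1 + ‖s • l‖ ^ 2) ^ (γ / 2))) := by
        have : Continuous fun s : ℝ => (1 + ‖s • l‖ ^ 2) ^ (γ / 2) :=
          Continuous.rpow_const (by fun_prop) fun s => Or.inl (by positivity)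
        fun_prop
      have := hcont.tendsto 0
      simp only [zero_smul, norm_zero, ne_eq, OfNat.ofNat_ne_zero, not_false_eq_true, zero_pow,
        add_zero, Real.one_rpow, mul_one] at this
      exact this.mono_left nhdsWithin_le_nhds
    have h3 := ((Complex.continuous_ofReal.tendsto _).comp (h1.mul h2)).const_mul
      (Complex.exp (Complex.I * ((⟪v, l⟫ : ℝ) : ℂ)))
    convert h3 using 2
    · simp only [Function.comp]; push_cast; ring
    · push_cast; ring

/-- The deterministic macro-scaling limit in the proof of Proposition 4: after
macro-scaling, only the Riesz exponent `|λ|^α` survives and the Bessel factor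
tends to `1`. -/
theorem macro_scaling_main_term
    (n : ℕ) (hn : 1 ≤ n) (μ α γ t t' : ℝ)
    (hμ : 0 < μ) (hα : 0 < α) (hγ : 0 ≤ γ) (ht : 0 < t) (ht' : 0 < t')
    (x x' : EuclideanSpace ℝ (Fin n)) (b : ℝ) (hb0 : 0 < b) (hbn : b < n)
    (L : ℝ → ℝ) (hLpos : ∀ y > 0, 0 < L y) (hL : SlowlyVaryingAtTop L)
    (hLbdd : ∀ M > 0, ∃ C, ∀ y ∈ Set.Ioc (0:ℝ) M, L y ≤ C)
    (k : ℕ) (hk : 1 ≤ k)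
    (g : EuclideanSpace ℝ (Fin n) → ℝ) (hgmeas : Measurable g)
    (hgnonneg : ∀ l, 0 ≤ g l)
    (hgbdd : ∀ δ₀ > 0, ∃ C, ∀ l : EuclideanSpace ℝ (Fin n), δ₀ ≤ ‖l‖ → g l ≤ C)
    (hgasymp : Tendsto
      (fun l : EuclideanSpace ℝ (Fin n) =>
        g l * ‖l‖ ^ ((n : ℝ) - b) / (tauberK n b * L (1 / ‖l‖) ^ k))
      (𝓝[≠] (0 : EuclideanSpace ℝ (Fin n))) (𝓝 1)) :
    Tendsto (fun ε : ℝ =>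
        (↑(ε ^ ((n : ℝ) / α) * (ε ^ (b / α) * L (ε ^ (-(1 / α))) ^ k)⁻¹) : ℂ) *
          ∫ l : EuclideanSpace ℝ (Fin n),
            Complex.exp (Complex.I * ((⟪x - x', l⟫ : ℝ) : ℂ)) *
              ↑(Real.exp (-(μ * (t + t') * ‖l‖ ^ α *
                  (1 + ‖(ε ^ (1 / α)) • l‖ ^ 2) ^ (γ / 2))) * g ((ε ^ (1 / α)) • l)))
      (𝓝[>] 0)
      (𝓝 ((tauberK n b : ℂ) *
        ∫ l : EuclideanSpace ℝ (Fin n),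
          Complex.exp (Complex.I * ((⟪x - x', l⟫ : ℝ) : ℂ)) *
            ↑(Real.exp (-(μ * (t + t') * ‖l‖ ^ α)) * ‖l‖ ^ (b - (n : ℝ))))) := by
  have hK : 0 < tauberK n b := by
    have h1 := Real.Gamma_pos_of_pos (s := ((n : ℝ) - b) / 2) (by linarith)
    have h2 := Real.Gamma_pos_of_pos (s := b / 2) (by linarith)
    unfold tauberK
    positivity
  have hs : Tendsto (fun ε : ℝ => ε ^ (1 / α)) (𝓝[>] 0) (𝓝[>] 0) := by
    have h1α : 0 < 1 / α := by positivity
    refine tendsto_nhdsWithin_iff.2 ⟨?_, ?_⟩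
    · have := (Real.continuous_rpow_const h1α.le).tendsto 0
      rw [Real.zero_rpow h1α.ne'] at this
      exact this.mono_left nhdsWithin_le_nhds
    · filter_upwards [self_mem_nhdsWithin] with ε hε
      exact Real.rpow_pos_of_pos hε _
  have h := (tendsto_scaled_integral hn (c := μ * (t + t')) (by positivity) hα hγ hb0 hbn hK
    (x - x') (fun y hy => pow_pos (hLpos y hy) k) (hL.pow k) hgmeas hgnonneg hgbdd
    hgasymp).comp hs
  rw [integral_const_mul] at h
  refine h.congr' ?_
  filter_upwards [self_mem_nhdsWithin] with ε hε
  have hε : 0 < ε := hε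
  simp only [Function.comp]
  rw [integral_const_mul]
  congr 2
  rw [← Real.rpow_mul hε.le, one_div (ε ^ (1 / α)), ← Real.rpow_neg hε.le, mul_inv, ← mul_assoc,
    ← div_eq_mul_inv, ← div_eq_mul_inv, ← Real.rpow_sub hε]
  congr 2
  ring
end

section
/- Let n ≥ 1, let m ≥ 1 be an integer, let 0 < κ with mκ < n, and let c, p > 0. Then the integral ∫_{ℝ^{n·m}} e^{−c|λ₁+⋯+λ_m|^{p}} ∏_{σ=1}^{m} |λ_σ|^{κ−n} dλ₁⋯dλ_m is finite, and equals r(n,m,κ)·∫_{ℝⁿ} e^{−c|λ|^{p}} |λ|^{mκ−n} dλ, where r(n,m,κ) := K(n,mκ)/K(n,κ)^m and K(n,a) := Γ((n−a)/2)/(2^a π^{n/2} Γ(a/2)). -/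
open MeasureTheory

open Real Set
open scoped ENNReal

/-- The weight `u ^ (α - 1) / Γ(α)` on the positive half-line, extended by zero. -/
noncomputable def gammaWeight (α u : ℝ) : ℝ≥0∞ :=
  if 0 < u then ENNReal.ofReal (u ^ (α - 1) / Gamma α) else 0

/-- The Gaussian probability density `(π u) ^ (-d / 2) * exp (-‖x‖ ^ 2 / u)`. -/
noncomputable def heatDensity (E : Type*) [NormedAddCommGroup E] [InnerProductSpace ℝ E]
    (u : ℝ) (x : E) : ℝ≥0∞ :=
  ENNReal.ofReal ((π * u) ^ (-(Module.finrank ℝ E / 2 : ℝ)) * exp (-(1 / u) * ‖x‖ ^ 2))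

/-- The subordination of the Gaussian densities to the gamma weights,
a multiple of the Riesz kernel. -/
noncomputable def rieszKernel {E : Type*} [NormedAddCommGroup E] [InnerProductSpace ℝ E]
    (a : ℝ) (x : E) : ℝ≥0∞ :=
  ∫⁻ u, gammaWeight (a / 2) u * heatDensity E u x

@[fun_prop]
lemma measurable_gammaWeight (α : ℝ) : Measurable (gammaWeight α) :=
  Measurable.ite measurableSet_Ioi (by fun_prop) (by fun_prop)

lemma gammaWeight_mul_gammaWeight {α β : ℝ} (hα : 0 < α) (hβ : 0 < β) {t : ℝ} (ht : 0 < t)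
    (u : ℝ) :
    gammaWeight α u * gammaWeight β (t - u) =
      gammaWeight (α + β) t *
        (ENNReal.ofReal t⁻¹ * ProbabilityTheory.betaPDF α β (t⁻¹ * u)) := by
  have hA := Gamma_pos_of_pos hα
  have hB := Gamma_pos_of_pos hβ
  have hAB := Gamma_pos_of_pos (add_pos hα hβ)
  by_cases hu : 0 < u
  · by_cases hut : u < t
    · have h1 : 0 < t⁻¹ * u := by positivity
      have h2 : t⁻¹ * u < 1 := by rw [inv_mul_lt_one₀ ht]; exact hut
      have h3 : 0 < t - u := sub_pos.2 hut
      rw [ProbabilityTheory.betaPDF_of_pos_lt_one h1 h2, gammaWeight, gammaWeight, gammaWeight,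
        if_pos hu, if_pos h3, if_pos ht, ← ENNReal.ofReal_mul (by positivity),
        ← ENNReal.ofReal_mul (by positivity), ← ENNReal.ofReal_mul (by positivity)]
      congr 1
      have e1 : 1 - t⁻¹ * u = t⁻¹ * (t - u) := by field_simp
      have e2 : t ^ (α + β - 1) = t ^ (α - 1) * t ^ (β - 1) * t := by
        rw [← rpow_add ht, ← rpow_add_one ht.ne']; congr 1; ring
      rw [e1, mul_rpow (by positivity) hu.le, mul_rpow (by positivity) h3.le, inv_rpow ht.le,
        inv_rpow ht.le, e2, ProbabilityTheory.beta]
      have := rpow_pos_of_pos ht (α - 1)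
      have := rpow_pos_of_pos ht (β - 1)
      field_simp
    · rw [ProbabilityTheory.betaPDF_eq_zero_of_one_le, gammaWeight, gammaWeight,
        if_neg (by linarith : ¬ 0 < t - u)]
      · simp
      · rw [le_inv_mul_iff₀ ht]; linarith
  · rw [ProbabilityTheory.betaPDF_eq_zero_of_nonpos, gammaWeight, if_neg hu]
    · simp
    · exact mul_nonpos_of_nonneg_of_nonpos (by positivity) (not_lt.1 hu)

lemma lintegral_comp_mul_left_mul {t : ℝ} (ht : 0 < t) {f : ℝ → ℝ≥0∞} (hf : Measurable f) :
    ∫⁻ u, ENNReal.ofReal t * f (t * u) = ∫⁻ u, f u := by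
  have h := Real.smul_map_volume_mul_left ht.ne'
  conv_rhs => rw [← h, lintegral_smul_measure, lintegral_map hf (by fun_prop), abs_of_pos ht]
  rw [lintegral_const_mul _ (by fun_prop), smul_eq_mul]

/-- The gamma weights form a convolution semigroup. -/
lemma lintegral_gammaWeight_mul {α β : ℝ} (hα : 0 < α) (hβ : 0 < β) (t : ℝ) :
    ∫⁻ u, gammaWeight α u * gammaWeight β (t - u) = gammaWeight (α + β) t := by
  by_cases ht : 0 < t
  · have hm : Measurable (ProbabilityTheory.betaPDF α β) := by
      unfold ProbabilityTheory.betaPDF; fun_prop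
    simp_rw [gammaWeight_mul_gammaWeight hα hβ ht]
    rw [lintegral_const_mul _ (by fun_prop), lintegral_comp_mul_left_mul (inv_pos.2 ht) hm,
      ProbabilityTheory.lintegral_betaPDF_eq_one hα hβ, mul_one]
  · rw [gammaWeight, if_neg ht, ← lintegral_zero (μ := (volume : Measure ℝ))]
    congr 1 with u
    by_cases hu : 0 < u
    · rw [gammaWeight, gammaWeight, if_neg (by linarith : ¬ 0 < t - u), mul_zero]
    · rw [gammaWeight, if_neg hu, zero_mul]

section Heat

variable {E : Type*} [NormedAddCommGroup E] [InnerProductSpace ℝ E]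

lemma heatDensity_mul_heatDensity {u v : ℝ} (hu : 0 < u) (hv : 0 < v) (x y : E) :
    heatDensity E u y * heatDensity E v (x - y) =
      heatDensity E (u + v) x * heatDensity E (u * v / (u + v)) (y - (u / (u + v)) • x) := by
  have huv : 0 < u + v := add_pos hu hv
  simp only [heatDensity]
  rw [← ENNReal.ofReal_mul (by positivity), ← ENNReal.ofReal_mul (by positivity),
    mul_mul_mul_comm, mul_mul_mul_comm ((π * (u + v)) ^ _), ← Real.exp_add, ← Real.exp_add,
    ← mul_rpow (by positivity) (by positivity), ← mul_rpow (by positivity) (by positivity)]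
  congr 3
  · field_simp
  · rw [norm_sub_sq_real, norm_sub_sq_real, inner_smul_right, norm_smul, mul_pow,
      real_inner_comm, Real.norm_eq_abs, sq_abs]
    field_simp
    ring

variable [MeasurableSpace E] [BorelSpace E]

@[fun_prop]
lemma measurable_heatDensity :
    Measurable fun q : ℝ × E => heatDensity E q.1 q.2 := by
  unfold heatDensity; fun_prop

@[fun_prop]
lemma measurable_rieszKernel (a : ℝ) : Measurable (rieszKernel (E := E) a) := by
  unfold rieszKernel
  have : Measurable fun q : E × ℝ => gammaWeight (a / 2) q.2 * heatDensity E q.2 q.1 :=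
    (by fun_prop : Measurable fun q : E × ℝ => gammaWeight (a / 2) q.2).mul
      (measurable_heatDensity.comp measurable_swap)
  exact this.lintegral_prod_right'

variable [FiniteDimensional ℝ E]

lemma lintegral_heatDensity {u : ℝ} (hu : 0 < u) : ∫⁻ x : E, heatDensity E u x = 1 := by
  have h := GaussianFourier.integral_rexp_neg_mul_sq_norm (V := E) (one_div_pos.2 hu)
  have hi : Integrable fun x : E => exp (-(1 / u) * ‖x‖ ^ 2) :=
    .of_integral_ne_zero (by rw [h]; positivity)
  simp only [heatDensity]
  rw [← ofReal_integral_eq_lintegral_ofReal (hi.const_mul _)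
    (.of_forall fun x => by positivity), integral_const_mul, h, div_div_eq_mul_div, div_one,
    ← rpow_add (by positivity), neg_add_cancel, rpow_zero, ENNReal.ofReal_one]

/-- The Gaussian densities form a convolution semigroup. -/
lemma lintegral_heatDensity_mul {u v : ℝ} (hu : 0 < u) (hv : 0 < v) (x : E) :
    ∫⁻ y, heatDensity E u y * heatDensity E v (x - y) = heatDensity E (u + v) x := by
  simp_rw [heatDensity_mul_heatDensity hu hv]
  have hm : Measurable (heatDensity E (u * v / (u + v))) := by unfold heatDensity; fun_prop
  rw [lintegral_const_mul _ (by fun_prop),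
    lintegral_sub_right_eq_self (heatDensity E (u * v / (u + v))),
    lintegral_heatDensity (by positivity), mul_one]

/-- The composition property of Riesz potentials. -/
lemma lintegral_rieszKernel_mul {a b : ℝ} (ha : 0 < a) (hb : 0 < b) (x : E) :
    ∫⁻ y, rieszKernel a y * rieszKernel b (x - y) = rieszKernel (a + b) x := by
  have hu (z : E) : Measurable fun u => heatDensity E u z := by unfold heatDensity; fun_prop
  have hx (u : ℝ) : Measurable fun z => heatDensity E u z := by unfold heatDensity; fun_prop
  calc ∫⁻ y, rieszKernel a y * rieszKernel b (x - y)
      = ∫⁻ y, ∫⁻ u, ∫⁻ v, (gammaWeight (a / 2) u * heatDensity E u y) *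
          (gammaWeight (b / 2) v * heatDensity E v (x - y)) := by
        refine lintegral_congr fun y => ?_
        rw [rieszKernel, rieszKernel, ← lintegral_mul_const _ (by fun_prop)]
        refine lintegral_congr fun u => ?_
        rw [lintegral_const_mul _ (by fun_prop)]
    _ = ∫⁻ u, ∫⁻ v, ∫⁻ y, (gammaWeight (a / 2) u * heatDensity E u y) *
          (gammaWeight (b / 2) v * heatDensity E v (x - y)) := by
        have hF : Measurable fun q : (E × ℝ) × ℝ =>
            (gammaWeight (a / 2) q.1.2 * heatDensity E q.1.2 q.1.1) *
            (gammaWeight (b / 2) q.2 * heatDensity E q.2 (x - q.1.1)) := by fun_prop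
        rw [lintegral_lintegral_swap hF.lintegral_prod_right'.aemeasurable]
        refine lintegral_congr fun u => ?_
        rw [lintegral_lintegral_swap]
        exact (hF.comp (by fun_prop : Measurable fun q : E × ℝ => ((q.1, u), q.2))).aemeasurable
    _ = ∫⁻ u, ∫⁻ v, gammaWeight (a / 2) u * gammaWeight (b / 2) v * heatDensity E (u + v) x := by
        refine lintegral_congr fun u => lintegral_congr fun v => ?_
        by_cases hu0 : 0 < u
        · by_cases hv0 : 0 < v
          · rw [lintegral_congr fun y => mul_mul_mul_comm _ _ _ _, lintegral_const_mul,
              lintegral_heatDensity_mul hu0 hv0]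
            exact (hx u).mul ((hx v).comp (by fun_prop))
          · simp [gammaWeight, hv0]
        · simp [gammaWeight, hu0]
    _ = ∫⁻ u, ∫⁻ t, gammaWeight (a / 2) u * gammaWeight (b / 2) (t - u) * heatDensity E t x := by
        refine lintegral_congr fun u => ?_
        conv_rhs => rw [← lintegral_add_left_eq_self _ u]
        simp only [add_sub_cancel_left]
    _ = ∫⁻ t, ∫⁻ u, gammaWeight (a / 2) u * gammaWeight (b / 2) (t - u) * heatDensity E t x := by
        refine lintegral_lintegral_swap (Measurable.aemeasurable ?_)
        have : Measurable fun q : ℝ × ℝ => heatDensity E q.2 x := (hu x).comp measurable_snd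
        unfold Function.uncurry
        fun_prop
    _ = rieszKernel (a + b) x := by
        refine lintegral_congr fun t => ?_
        rw [lintegral_mul_const _ (by fun_prop),
          lintegral_gammaWeight_mul (half_pos ha) (half_pos hb), add_div]

/-- The `m`-fold composition property of Riesz potentials. -/
lemma lintegral_comp_sum_mul_prod_rieszKernel {a : ℝ} (ha : 0 < a) (m : ℕ) {F : E → ℝ≥0∞}
    (hF : Measurable F) :
    ∫⁻ l : Fin (m + 1) → E, F (∑ i, l i) * ∏ i, rieszKernel a (l i) =
      ∫⁻ x, F x * rieszKernel ((m + 1 : ℕ) * a) x := by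
  induction m generalizing F with
  | zero =>
    have h := (volume_preserving_funUnique (Fin 1) E).lintegral_comp_emb
      (MeasurableEquiv.measurableEmbedding _) fun x => F x * rieszKernel a x
    simp only [zero_add, Nat.cast_one, one_mul]
    convert! h
    · exact funext fun l : Fin 1 → E => Fin.sum_univ_one l
    · exact Fin.prod_univ_one _
  | succ m ih =>
    have h := (volume_preserving_piFinSuccAbove (fun _ : Fin (m + 2) => E) 0).lintegral_comp_emb
      (MeasurableEquiv.measurableEmbedding _)
      fun q => F (q.1 + ∑ i, q.2 i) * (rieszKernel a q.1 * ∏ i, rieszKernel a (q.2 i))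
    have hsum : ∀ l : Fin (m + 2) → E, F (∑ i, l i) * ∏ i, rieszKernel a (l i) =
        F (l 0 + ∑ i : Fin (m + 1), l i.succ) *
          (rieszKernel a (l 0) * ∏ i : Fin (m + 1), rieszKernel a (l i.succ)) := fun l => by
      rw [Fin.sum_univ_succ, Fin.prod_univ_succ]
    simp_rw [hsum]
    refine Eq.trans h ?_
    rw [Measure.volume_eq_prod, lintegral_prod _ (by fun_prop)]
    calc ∫⁻ x, ∫⁻ l : Fin (m + 1) → E,
          F (x + ∑ i, l i) * (rieszKernel a x * ∏ i, rieszKernel a (l i))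
        = ∫⁻ x, ∫⁻ y, rieszKernel a x * (F y * rieszKernel ((m + 1 : ℕ) * a) (y - x)) := by
          refine lintegral_congr fun x => ?_
          simp_rw [mul_left_comm (F _)]
          rw [lintegral_const_mul _ (by fun_prop), lintegral_const_mul _ (by fun_prop),
            ih (F := fun y => F (x + y)) (by fun_prop)]
          conv_rhs => rw [← lintegral_add_left_eq_self _ x]
          simp only [add_sub_cancel_left]
      _ = ∫⁻ y, ∫⁻ x, rieszKernel a x * (F y * rieszKernel ((m + 1 : ℕ) * a) (y - x)) := by
          refine lintegral_lintegral_swap (Measurable.aemeasurable ?_)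
          unfold Function.uncurry
          fun_prop
      _ = _ := by
          refine lintegral_congr fun y => ?_
          simp_rw [mul_left_comm _ (F y)]
          rw [lintegral_const_mul _ (by fun_prop), lintegral_rieszKernel_mul ha (by positivity)]
          congr 2
          push_cast
          ring

end Heat

lemma lintegral_Ioi_eq_lintegral_inv (f : ℝ → ℝ≥0∞) :
    ∫⁻ u in Ioi 0, f u = ∫⁻ s in Ioi 0, ENNReal.ofReal (s ^ 2)⁻¹ * f s⁻¹ := by
  have h := lintegral_image_eq_lintegral_abs_deriv_mul (s := Ioi (0 : ℝ)) (f := fun s => s⁻¹)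
    (f' := fun s => -(s ^ 2)⁻¹) measurableSet_Ioi
    (fun s hs => (hasDerivAt_inv (ne_of_gt hs)).hasDerivWithinAt) (inv_injective.injOn) f
  have him : (fun s : ℝ => s⁻¹) '' Ioi 0 = Ioi 0 := by
    rw [Set.image_inv_eq_inv]; ext; simp
  rw [him] at h
  rw [h]
  refine setLIntegral_congr_fun measurableSet_Ioi fun s _ => ?_
  simp only [abs_neg, abs_of_nonneg (inv_nonneg.2 (sq_nonneg s))]

lemma rieszKernel_eq {n : ℕ} {a : ℝ} (ha : 0 < a) (han : a < n) {x : EuclideanSpace ℝ (Fin n)}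
    (hx : x ≠ 0) :
    rieszKernel a x = ENNReal.ofReal (2 ^ a * tauberK n a * ‖x‖ ^ (a - n)) := by
  have hr : 0 < ‖x‖ := norm_pos_iff.2 hx
  have hA := Gamma_pos_of_pos (half_pos ha)
  have hb : 0 < ((n : ℝ) - a) / 2 := by linarith
  have hind : (fun u => gammaWeight (a / 2) u * heatDensity (EuclideanSpace ℝ (Fin n)) u x) =
      (Ioi 0).indicator fun u => ENNReal.ofReal (u ^ (a / 2 - 1) / Gamma (a / 2)) *
        heatDensity (EuclideanSpace ℝ (Fin n)) u x := by
    ext u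
    by_cases hu : 0 < u <;> simp [gammaWeight, hu]
  have hint := integral_rpow_mul_exp_neg_mul_Ioi hb (sq_pos_of_pos hr)
  have hi : IntegrableOn (fun t => t ^ (((n : ℝ) - a) / 2 - 1) * exp (-(‖x‖ ^ 2 * t))) (Ioi 0) :=
    .of_integral_ne_zero (by rw [hint]; have := Gamma_pos_of_pos hb; positivity)
  rw [rieszKernel, hind, lintegral_indicator measurableSet_Ioi, lintegral_Ioi_eq_lintegral_inv]
  calc _ = ∫⁻ s in Ioi 0, ENNReal.ofReal (π ^ (-(n / 2 : ℝ)) / Gamma (a / 2) *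
        (s ^ (((n : ℝ) - a) / 2 - 1) * exp (-(‖x‖ ^ 2 * s)))) := by
        refine setLIntegral_congr_fun measurableSet_Ioi fun s hs => ?_
        have hs : 0 < s := hs
        simp only [heatDensity, finrank_euclideanSpace_fin]
        rw [← ENNReal.ofReal_mul (by positivity), ← ENNReal.ofReal_mul (by positivity)]
        congr 1
        have e : s ^ (((n : ℝ) - a) / 2 - 1) =
            (s ^ 2)⁻¹ * s⁻¹ ^ (a / 2 - 1) * s⁻¹ ^ (-(n / 2 : ℝ)) := by
          rw [inv_rpow hs.le, inv_rpow hs.le, ← rpow_neg hs.le, ← rpow_neg hs.le, ← rpow_natCast,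
            ← rpow_neg hs.le, ← rpow_add hs, ← rpow_add hs]
          congr 1; push_cast; ring
        rw [mul_rpow pi_pos.le (by positivity), e, one_div, inv_inv,
          show -s * ‖x‖ ^ 2 = -(‖x‖ ^ 2 * s) by ring]
        ring
    _ = _ := by
        rw [← ofReal_integral_eq_lintegral_ofReal (hi.const_mul _), integral_const_mul, hint]
        · congr 1
          have e : (1 / ‖x‖ ^ 2) ^ (((n : ℝ) - a) / 2) = ‖x‖ ^ (a - n) := by
            rw [one_div, ← rpow_natCast, ← rpow_neg hr.le, ← rpow_mul hr.le]
            congr 1; push_cast; ring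
          have h2 : (0 : ℝ) < 2 ^ a := by positivity
          rw [e, tauberK, rpow_neg pi_pos.le]
          have : 0 < π ^ ((n : ℝ) / 2) := by positivity
          field_simp
        · filter_upwards [ae_restrict_mem measurableSet_Ioi] with s hs
          have hs : 0 < s := hs
          have := hA
          simp only [Pi.zero_apply]
          positivity

lemma integrable_exp_neg_mul_norm_rpow {n : ℕ} (hn : 1 ≤ n) {c p a : ℝ} (hc : 0 < c) (hp : 0 < p)
    (ha : 0 < a) :
    Integrable fun x : EuclideanSpace ℝ (Fin n) => exp (-c * ‖x‖ ^ p) * ‖x‖ ^ (a - n) := by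
  have : Nonempty (Fin n) := ⟨⟨0, hn⟩⟩
  rw [integrable_fun_norm_addHaar volume (f := fun r => exp (-c * r ^ p) * r ^ (a - n))]
  refine (integrableOn_rpow_mul_exp_neg_mul_rpow (s := a - 1) (by linarith) hp hc).congr_fun
    (fun r hr => ?_) measurableSet_Ioi
  have hr : 0 < r := hr
  simp only [finrank_euclideanSpace_fin, smul_eq_mul]
  rw [mul_left_comm, ← rpow_natCast, ← rpow_add hr, mul_comm, Nat.cast_sub hn]
  congr 2; push_cast; ring

lemma tauberK_pos {n : ℕ} {a : ℝ} (ha : 0 < a) (han : a < n) : 0 < tauberK n a := by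
  have h1 := Gamma_pos_of_pos (half_pos ha)
  have h2 := Gamma_pos_of_pos (by linarith : 0 < ((n : ℝ) - a) / 2)
  unfold tauberK
  positivity

lemma ofReal_norm_rpow_eq {n : ℕ} {a : ℝ} (ha : 0 < a) (han : a < n)
    {x : EuclideanSpace ℝ (Fin n)} (hx : x ≠ 0) :
    ENNReal.ofReal (‖x‖ ^ (a - n)) =
      ENNReal.ofReal (2 ^ a * tauberK n a)⁻¹ * rieszKernel a x := by
  have := tauberK_pos ha han
  rw [rieszKernel_eq ha han hx, ← ENNReal.ofReal_mul (by positivity), inv_mul_cancel_left₀]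
  positivity

lemma lintegral_comp_sum_mul_prod_norm_rpow {n m : ℕ} (hn : 1 ≤ n) (hm : 1 ≤ m) {κ : ℝ}
    (hκ : 0 < κ) (hmκ : (m : ℝ) * κ < n) {F : EuclideanSpace ℝ (Fin n) → ℝ≥0∞}
    (hF : Measurable F) :
    ∫⁻ l : Fin m → EuclideanSpace ℝ (Fin n),
        F (∑ i, l i) * ∏ i, ENNReal.ofReal (‖l i‖ ^ (κ - n)) =
      ENNReal.ofReal (tauberK n (m * κ) / tauberK n κ ^ m) *
        ∫⁻ x, F x * ENNReal.ofReal (‖x‖ ^ (m * κ - n)) := by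
  have : Nonempty (Fin n) := ⟨⟨0, hn⟩⟩
  have hm' : (1 : ℝ) ≤ m := by exact_mod_cast hm
  have hκn : κ < n := by nlinarith
  have hm0 : 0 < m * κ := by positivity
  have hK := tauberK_pos hκ hκn
  have hKm := tauberK_pos hm0 hmκ
  have hne : ∀ᵐ x : EuclideanSpace ℝ (Fin n), x ≠ 0 := by
    simp [ae_iff]
  have hne' : ∀ᵐ l : Fin m → EuclideanSpace ℝ (Fin n), ∀ i, l i ≠ 0 :=
    ae_all_iff.2 fun i => (Measure.quasiMeasurePreserving_eval
      (fun _ : Fin m => (volume : Measure (EuclideanSpace ℝ (Fin n)))) i).ae hne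
  calc _ = ∫⁻ l : Fin m → EuclideanSpace ℝ (Fin n),
        ENNReal.ofReal (2 ^ κ * tauberK n κ)⁻¹ ^ m *
          (F (∑ i, l i) * ∏ i, rieszKernel κ (l i)) := by
        refine lintegral_congr_ae ?_
        filter_upwards [hne'] with l hl
        rw [Finset.prod_congr rfl fun i _ => ofReal_norm_rpow_eq hκ hκn (hl i),
          Finset.prod_mul_distrib]
        simp [mul_left_comm]
    _ = ENNReal.ofReal (2 ^ κ * tauberK n κ)⁻¹ ^ m * ∫⁻ x, F x * rieszKernel (m * κ) x := by
        rw [lintegral_const_mul _ (by fun_prop)]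
        obtain ⟨k, rfl⟩ := Nat.exists_eq_add_of_le' hm
        rw [lintegral_comp_sum_mul_prod_rieszKernel hκ k hF]
    _ = ENNReal.ofReal (2 ^ κ * tauberK n κ)⁻¹ ^ m * ∫⁻ x,
        ENNReal.ofReal (2 ^ (m * κ) * tauberK n (m * κ)) *
          (F x * ENNReal.ofReal (‖x‖ ^ (m * κ - n))) := by
        congr 1
        refine lintegral_congr_ae ?_
        filter_upwards [hne] with x hx
        rw [rieszKernel_eq hm0 hmκ hx, ENNReal.ofReal_mul (by positivity), mul_left_comm]
    _ = _ := by
        rw [lintegral_const_mul _ (by fun_prop), ← mul_assoc,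
          ← ENNReal.ofReal_pow (by positivity), ← ENNReal.ofReal_mul (by positivity)]
        congr 2
        have h2 : (0 : ℝ) < 2 ^ κ := by positivity
        rw [mul_comm (m : ℝ) κ, rpow_mul (by norm_num), rpow_natCast,
          inv_pow, mul_pow]
        field_simp

/-- The finiteness and reduction claim (7.18): the `m`-fold Riesz kernel integral
arising from the L² norm of the limiting multiple Wiener–Itô kernel reduces to a
single Riesz-type integral, with constant `r(n,m,κ) = K(n,mκ)/K(n,κ)^m`. -/
theorem multiple_riesz_integral_reduction
    (n m : ℕ) (hn : 1 ≤ n) (hm : 1 ≤ m) (κ : ℝ) (hκ : 0 < κ)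
    (hmκ : (m : ℝ) * κ < n) (c p : ℝ) (hc : 0 < c) (hp : 0 < p) :
    Integrable (fun l : Fin m → EuclideanSpace ℝ (Fin n) =>
        Real.exp (-c * ‖∑ σ, l σ‖ ^ p) * ∏ σ, ‖l σ‖ ^ (κ - (n : ℝ))) ∧
      ∫ l : Fin m → EuclideanSpace ℝ (Fin n),
          Real.exp (-c * ‖∑ σ, l σ‖ ^ p) * ∏ σ, ‖l σ‖ ^ (κ - (n : ℝ))
        = (tauberK n ((m : ℝ) * κ) / tauberK n κ ^ m) *
            ∫ l : EuclideanSpace ℝ (Fin n),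
              Real.exp (-c * ‖l‖ ^ p) * ‖l‖ ^ ((m : ℝ) * κ - (n : ℝ)) := by
  have hF : Measurable fun x : EuclideanSpace ℝ (Fin n) =>
      ENNReal.ofReal (exp (-c * ‖x‖ ^ p)) := by fun_prop
  have hm0 : 0 < (m : ℝ) * κ := mul_pos (by exact_mod_cast hm) hκ
  have hκn : κ < n := by
    have : (1 : ℝ) ≤ m := by exact_mod_cast hm
    nlinarith
  have hr : 0 ≤ tauberK n (m * κ) / tauberK n κ ^ m :=
    div_nonneg (tauberK_pos hm0 hmκ).le (pow_nonneg (tauberK_pos hκ hκn).le m)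
  have hint := integrable_exp_neg_mul_norm_rpow hn hc hp hm0
  have hlint : ∫⁻ l : Fin m → EuclideanSpace ℝ (Fin n),
      ENNReal.ofReal (exp (-c * ‖∑ σ, l σ‖ ^ p) * ∏ σ, ‖l σ‖ ^ (κ - (n : ℝ))) =
      ENNReal.ofReal (tauberK n (m * κ) / tauberK n κ ^ m *
        ∫ x : EuclideanSpace ℝ (Fin n), exp (-c * ‖x‖ ^ p) * ‖x‖ ^ (m * κ - n)) := by
    rw [ENNReal.ofReal_mul hr,
      ofReal_integral_eq_lintegral_ofReal hint (.of_forall fun x => by positivity)]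
    simp_rw [ENNReal.ofReal_mul (exp_pos _).le]
    rw [← lintegral_comp_sum_mul_prod_norm_rpow hn hm hκ hmκ hF]
    refine lintegral_congr fun l => ?_
    rw [ENNReal.ofReal_prod_of_nonneg fun i _ => by positivity]
  have hmeas : Measurable fun l : Fin m → EuclideanSpace ℝ (Fin n) =>
      exp (-c * ‖∑ σ, l σ‖ ^ p) * ∏ σ, ‖l σ‖ ^ (κ - (n : ℝ)) := by fun_prop
  have hnonneg : 0 ≤ᵐ[volume] fun l : Fin m → EuclideanSpace ℝ (Fin n) =>
      exp (-c * ‖∑ σ, l σ‖ ^ p) * ∏ σ, ‖l σ‖ ^ (κ - (n : ℝ)) :=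
    .of_forall fun l => mul_nonneg (exp_pos _).le (Finset.prod_nonneg fun i _ => by positivity)
  refine ⟨⟨hmeas.aestronglyMeasurable, ?_⟩, ?_⟩
  · rw [hasFiniteIntegral_iff_ofReal hnonneg, hlint]
    exact ENNReal.ofReal_lt_top
  · rw [integral_eq_lintegral_of_nonneg_ae hnonneg hmeas.aestronglyMeasurable, hlint,
      ENNReal.toReal_ofReal]
    exact mul_nonneg hr (integral_nonneg fun x => by positivity)
end
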